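/- arXiv:2005.07405 — 2 statements merged into one kernel-verified Lean document; each statement's English description precedes it below -/
import Mathlib

section
/- Let d ≥ 1, let V be an additive commutative group, and let Q : ℕ^d → V satisfy Q(k) = 0 whenever some component of k equals 0. Define the mixed detail operator Δ^mix[Q](k) = Σ_{j ∈ {0,1}^d} (−1)^{j_1+⋯+j_d} Q(k − j). Let Λ be a finite downward closed subset of {k ∈ ℕ^d : k_l ≥ 1 for all l}. Then the combination-technique identity for the MISC estimator holds: Σ_{k ∈ Λ} Δ^mix[Q](k) = Σ_{k ∈ Λ} c_k • Q(k), where the integer coefficients are c_k = Σ_{j ∈ {0,1}^d : k + j ∈ Λ} (−1)^{j_1+⋯+j_d}. -/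
/-- The `l`-th canonical multi-index `e_l : ℕ^d`. -/
def canonicalMultiIndex (d : ℕ) (l : Fin d) : Fin d → ℕ :=
  fun m => if m = l then 1 else 0

/-- The mixed detail operator in combination-technique form:
`Δ^mix[Q](k) = Σ_{j ∈ {0,1}^d} (−1)^{|j|} Q(k − j)`,
with componentwise truncated subtraction on `ℕ`. -/
def mixedDetail {d : ℕ} {V : Type*} [AddCommGroup V]
    (Q : (Fin d → ℕ) → V) (k : Fin d → ℕ) : V :=
  ∑ j : Fin d → Fin 2,
    ((-1 : ℤ) ^ (∑ l : Fin d, (j l : ℕ))) • Q (k - fun m => (j m : ℕ))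

/-- Subtracting a `{0,1}`-valued multi-index with positive result stays in a downward closed set. -/
theorem sub_mem_of_downwardClosed {d : ℕ} {Λ : Finset (Fin d → ℕ)}
    (hdc : ∀ k ∈ Λ, ∀ l : Fin d, 1 < k l → k - canonicalMultiIndex d l ∈ Λ)
    {k : Fin d → ℕ} (hk : k ∈ Λ) (j : Fin d → Fin 2) (hj : ∀ l, (j l : ℕ) < k l) :
    (k - fun m => (j m : ℕ)) ∈ Λ := by
  have key : ∀ S : Finset (Fin d), (∀ l ∈ S, 1 < k l) →
      (k - fun m => if m ∈ S then 1 else 0) ∈ Λ := by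
    intro S
    induction S using Finset.induction_on with
    | empty =>
      intro _
      convert hk using 1
      ext m
      simp
    | insert a S ha ih =>
      intro h
      have hS := ih fun l hl => h l (Finset.mem_insert_of_mem hl)
      have ha1 := h a (Finset.mem_insert_self a S)
      convert hdc _ hS a (by simpa [ha] using ha1) using 1
      ext m
      by_cases hm : m = a
      · subst hm
        simp [canonicalMultiIndex, ha]
      · simp [canonicalMultiIndex, hm]
  convert key {l | j l = 1} (fun l hl => ?_) using 2
  · ext m
    rcases Fin.exists_fin_two.mp ⟨j m, rfl⟩ with h | h <;> simp [h]
  · have h1 : j l = 1 := by simpa using hl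
    simpa [h1] using hj l

/-- Reindexing a shifted sum over a downward closed set, for `Q` vanishing on the coordinate
hyperplanes. -/
theorem sum_shift_of_downwardClosed {d : ℕ} {V : Type*} [AddCommGroup V]
    {Q : (Fin d → ℕ) → V} (hQ : ∀ k : Fin d → ℕ, (∃ l : Fin d, k l = 0) → Q k = 0)
    {Λ : Finset (Fin d → ℕ)} (hpos : ∀ k ∈ Λ, ∀ l : Fin d, 1 ≤ k l)
    (hdc : ∀ k ∈ Λ, ∀ l : Fin d, 1 < k l → k - canonicalMultiIndex d l ∈ Λ)
    (j : Fin d → Fin 2) :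
    ∑ k ∈ Λ, Q (k - fun m => (j m : ℕ)) =
      ∑ k ∈ Λ with (k + fun m => (j m : ℕ)) ∈ Λ, Q k := by
  have hsub : ∑ k ∈ Λ with ∀ l, (j l : ℕ) < k l, Q (k - fun m => (j m : ℕ)) =
      ∑ k ∈ Λ, Q (k - fun m => (j m : ℕ)) := by
    refine Finset.sum_filter_of_ne fun k _ hne l => ?_
    by_contra hl
    exact hne (hQ _ ⟨l, Nat.sub_eq_zero_of_le (not_lt.mp hl)⟩)
  have hcancel : ∀ k : Fin d → ℕ, (∀ l, (j l : ℕ) < k l) →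
      ((k - fun m => (j m : ℕ)) + fun m => (j m : ℕ)) = k := fun k hk =>
    funext fun l => Nat.sub_add_cancel (hk l).le
  rw [← hsub]
  refine Finset.sum_nbij' (fun k => k - fun m => (j m : ℕ)) (fun k => k + fun m => (j m : ℕ))
    (fun k hk => ?_) (fun k hk => ?_) (fun k hk => ?_) (fun k _ => ?_) (fun _ _ => rfl)
  · rw [Finset.mem_filter] at hk ⊢
    refine ⟨sub_mem_of_downwardClosed hdc hk.1 j hk.2, ?_⟩
    rw [hcancel k hk.2]
    exact hk.1
  · rw [Finset.mem_filter] at hk ⊢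
    refine ⟨hk.2, fun l => ?_⟩
    have := hpos k hk.1 l
    simp only [Pi.add_apply]
    omega
  · exact hcancel k (Finset.mem_filter.mp hk).2
  · exact funext fun l => Nat.add_sub_cancel (k l) (j l)

theorem misc_combination_technique
    (d : ℕ) (hd : 1 ≤ d) (V : Type*) [AddCommGroup V]
    (Q : (Fin d → ℕ) → V)
    (hQ : ∀ k : Fin d → ℕ, (∃ l : Fin d, k l = 0) → Q k = 0)
    (Λ : Finset (Fin d → ℕ))
    (hpos : ∀ k ∈ Λ, ∀ l : Fin d, 1 ≤ k l)
    (hdc : ∀ k ∈ Λ, ∀ l : Fin d, 1 < k l → k - canonicalMultiIndex d l ∈ Λ) :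
    ∑ k ∈ Λ, mixedDetail Q k =
      ∑ k ∈ Λ,
        (∑ j : Fin d → Fin 2,
          if (k + fun m => (j m : ℕ)) ∈ Λ then
            (-1 : ℤ) ^ (∑ l : Fin d, (j l : ℕ)) else 0) • Q k := by
  simp only [mixedDetail, Finset.sum_smul]
  rw [Finset.sum_comm, Finset.sum_comm (s := Λ)]
  refine Finset.sum_congr rfl fun j _ => ?_
  rw [← Finset.smul_sum, sum_shift_of_downwardClosed hQ hpos hdc j, Finset.smul_sum,
    Finset.sum_filter]
  exact Finset.sum_congr rfl fun k _ => by rw [ite_smul, zero_smul]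
end

section
/- Let X be a type, let N ≥ 1, and let (S_i)_{i ≥ 1} be a family of finite subsets of X that is nested, i.e., S_i ⊆ S_{i+1} for all i ≥ 1; set S_0 = ∅. For a multi-index β ∈ ℕ^N with all components ≥ 1, define the tensor grid T_β = {y ∈ X^N : y_n ∈ S_{β_n} for all n}. Then the set of new points of T_β, namely T_β with all tensor grids of strictly smaller multi-indices removed, T_β \ ⋃ {T_{β'} : β' ∈ ℕ^N, all components of β' ≥ 1, β' ≤ β componentwise, β' ≠ β}, equals the Cartesian product ∏_{n=1}^N (S_{β_n} \ S_{β_n − 1}); consequently its cardinality is ∏_{n=1}^N (|S_{β_n}| − |S_{β_n − 1}|). -/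
theorem tensor_grid_new_points
    (X : Type*) [DecidableEq X] (N : ℕ) (hN : 1 ≤ N)
    (S : ℕ → Finset X) (hS0 : S 0 = ∅)
    (hnested : ∀ i : ℕ, 1 ≤ i → S i ⊆ S (i + 1))
    (β : Fin N → ℕ) (hβ : ∀ n : Fin N, 1 ≤ β n)
    -- the tensor grid `T_{β'} = {y ∈ X^N : y_n ∈ S_{β'_n} for all n}`
    (T : (Fin N → ℕ) → Finset (Fin N → X))
    (hT : ∀ β' : Fin N → ℕ, T β' = Fintype.piFinset fun n => S (β' n)) :
    T β \ ((Finset.Icc (1 : Fin N → ℕ) β).erase β).biUnion T =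
        (Fintype.piFinset fun n => S (β n) \ S (β n - 1)) ∧
      (T β \ ((Finset.Icc (1 : Fin N → ℕ) β).erase β).biUnion T).card =
        ∏ n : Fin N, ((S (β n)).card - (S (β n - 1)).card) := by
  have hmono : Monotone S := monotone_nat_of_le_succ fun i => by
    rcases Nat.eq_zero_or_pos i with rfl | hi
    · simp [hS0]
    · exact hnested i hi
  have hset : T β \ ((Finset.Icc (1 : Fin N → ℕ) β).erase β).biUnion T =
      Fintype.piFinset fun n => S (β n) \ S (β n - 1) := by
    ext y
    simp only [Finset.mem_sdiff, Finset.mem_biUnion, Finset.mem_erase, Finset.mem_Icc, hT,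
      Fintype.mem_piFinset, not_exists, not_and]
    constructor
    · rintro ⟨hy, hnew⟩ n
      refine ⟨hy n, fun hn => ?_⟩
      have hpred : 1 ≤ β n - 1 := by
        by_contra h
        rw [show β n - 1 = 0 by omega, hS0] at hn
        simp at hn
      refine hnew (Function.update β n (β n - 1)) ⟨fun h => ?_, ?_, ?_⟩ fun k => ?_
      · have := congrFun h n
        rw [Function.update_self] at this
        omega
      · exact le_update_iff.2 ⟨hpred, fun k _ => hβ k⟩
      · exact update_le_iff.2 ⟨Nat.sub_le _ _, fun _ _ => le_rfl⟩
      · rcases eq_or_ne k n with rfl | hk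
        · rwa [Function.update_self]
        · rw [Function.update_of_ne hk]
          exact hy k
    · intro hy
      refine ⟨fun n => (hy n).1, fun β' ⟨hne, _, hle⟩ hy' => ?_⟩
      obtain ⟨n, hn⟩ := Function.ne_iff.1 hne
      have hlt : β' n < β n := lt_of_le_of_ne (hle n) hn
      exact (hy n).2 (hmono (Nat.le_sub_one_of_lt hlt) (hy' n))
  refine ⟨hset, ?_⟩
  rw [hset, Fintype.card_piFinset]
  exact Finset.prod_congr rfl fun n _ => Finset.card_sdiff_of_subset (hmono (Nat.sub_le _ _))
end
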